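/- arXiv:2306.06444 — 2 statements merged into one kernel-verified Lean document; each statement's English description precedes it below -/
import Mathlib

section
/- Let ω ∈ ℂ and let (β_n)_{n≥0}, (γ_{n+1})_{n≥0}, (β̃_n)_{n≥0}, (γ̃_{n+1})_{n≥0} be complex sequences satisfying the six equations: (n+2)β̃_n − nβ̃_{n−1} = (n+1)β_{n+1} − (n−1)β_n − ω (n ≥ 1); 2β̃_0 = β_1 + β_0 − ω; (n+3)γ̃_{n+1} − (n+1)γ̃_n = (n+1)γ_{n+2} − (n−1)γ_{n+1} + (n+1)(β_{n+1} − β̃_n)(β_{n+1} − β̃_n − ω) (n ≥ 1); 3γ̃_1 = γ_2 + γ_1 + (β_1 − β̃_0)(β_1 − β̃_0 − ω); (n+1)γ̃_n(2β_{n+1} − β̃_n − β̃_{n−1} − ω) − nγ_{n+1}(β_{n+1} + β_n − 2β̃_{n−1} − ω) = 0 (n ≥ 1); (n+2)γ̃_n γ̃_{n+1} − 2(n+1)γ̃_n γ_{n+2} + nγ_{n+1}γ_{n+2} = 0 (n ≥ 1). Assume γ_{n+1} ≠ 0 and γ̃_{n+1} ≠ 0 for all n ≥ 0, and define δ_n :=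 β̃_n − β_{n+1} for n ≥ 0 (with δ_{−1} := 0) and θ_n := (n+1)γ̃_n/(n γ_{n+1}) for n ≥ 1. Then: β_{n+1} − β_n = nδ_{n−1} − (n+2)δ_n − ω for all n ≥ 0; [(n+3)(θ_{n+1} − 1) + 1]·γ_{n+2}/(n+2) − [n(θ_n − 1) + 1]·γ_{n+1}/(n+1) = δ_n(δ_n + ω) for all n ≥ 1; (3θ_1 − 2)γ_2 − 2γ_1 = 2δ_0(δ_0 + ω); [(n+3)(θ_n − 1) + 1]δ_n − [(n−1)(θ_n − 1) + 1]δ_{n−1} + 2(θ_n − 1)ω = 0 for all n ≥ 1; and (θ_{n+1} − 2)θ_n + 1 = 0 for all n ≥ 1. -/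
open Polynomial

/-- The Hahn difference operator `D_ω` acting on polynomials:
`(D_ω f)(x) = (f(x+ω) − f(x))/ω`. -/
noncomputable def Dw (ω : ℂ) (f : Polynomial ℂ) : Polynomial ℂ :=
  C ω⁻¹ * (f.comp (X + C ω) - f)

/-- A monic polynomial sequence: each `P n` is monic of degree `n`. -/
def MonicPS (P : ℕ → Polynomial ℂ) : Prop :=
  ∀ n, (P n).Monic ∧ (P n).natDegree = n

/-- Three-term recurrence with coefficients `β`, `γ` (where `γ (n+1)` is used). -/
def TTR (P : ℕ → Polynomial ℂ) (β γ : ℕ → ℂ) : Prop :=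
  P 0 = 1 ∧ P 1 = X - C (β 0) ∧
    ∀ n : ℕ, P (n + 2) = (X - C (β (n + 1))) * P (n + 1) - C (γ (n + 1)) * P n

/-- Orthogonality of a polynomial sequence with respect to a linear functional. -/
def IsOPSwrt (P : ℕ → Polynomial ℂ) (u : Polynomial ℂ →ₗ[ℂ] ℂ) : Prop :=
  (∀ n m, n ≠ m → u (P n * P m) = 0) ∧ ∀ n, u (P n * P n) ≠ 0

theorem transformed_system_in_delta_theta
    (ω : ℂ) (β γ tβ tγ δ θ : ℕ → ℂ)
    (h1 : ∀ n : ℕ, 1 ≤ n →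
        ((n : ℂ) + 2) * tβ n - (n : ℂ) * tβ (n - 1)
          = ((n : ℂ) + 1) * β (n + 1) - ((n : ℂ) - 1) * β n - ω)
    (h2 : 2 * tβ 0 = β 1 + β 0 - ω)
    (h3 : ∀ n : ℕ, 1 ≤ n →
        ((n : ℂ) + 3) * tγ (n + 1) - ((n : ℂ) + 1) * tγ n
          = ((n : ℂ) + 1) * γ (n + 2) - ((n : ℂ) - 1) * γ (n + 1)
            + ((n : ℂ) + 1) * (β (n + 1) - tβ n) * (β (n + 1) - tβ n - ω))
    (h4 : 3 * tγ 1 = γ 2 + γ 1 + (β 1 - tβ 0) * (β 1 - tβ 0 - ω))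
    (h5 : ∀ n : ℕ, 1 ≤ n →
        ((n : ℂ) + 1) * tγ n * (2 * β (n + 1) - tβ n - tβ (n - 1) - ω)
          - (n : ℂ) * γ (n + 1) * (β (n + 1) + β n - 2 * tβ (n - 1) - ω) = 0)
    (h6 : ∀ n : ℕ, 1 ≤ n →
        ((n : ℂ) + 2) * tγ n * tγ (n + 1) - 2 * ((n : ℂ) + 1) * tγ n * γ (n + 2)
          + (n : ℂ) * γ (n + 1) * γ (n + 2) = 0)
    (hγ : ∀ n : ℕ, γ (n + 1) ≠ 0) (htγ : ∀ n : ℕ, tγ (n + 1) ≠ 0)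
    (hδ : ∀ n, δ n = tβ n - β (n + 1))
    (hθ : ∀ n : ℕ, 1 ≤ n → θ n = ((n : ℂ) + 1) * tγ n / ((n : ℂ) * γ (n + 1))) :
    (β 1 - β 0 = -2 * δ 0 - ω) ∧
    (∀ n : ℕ, 1 ≤ n →
        β (n + 1) - β n = (n : ℂ) * δ (n - 1) - ((n : ℂ) + 2) * δ n - ω) ∧
    (∀ n : ℕ, 1 ≤ n →
        (((n : ℂ) + 3) * (θ (n + 1) - 1) + 1) * γ (n + 2) / ((n : ℂ) + 2)
          - ((n : ℂ) * (θ n - 1) + 1) * γ (n + 1) / ((n : ℂ) + 1)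
          = δ n * (δ n + ω)) ∧
    ((3 * θ 1 - 2) * γ 2 - 2 * γ 1 = 2 * δ 0 * (δ 0 + ω)) ∧
    (∀ n : ℕ, 1 ≤ n →
        (((n : ℂ) + 3) * (θ n - 1) + 1) * δ n
          - (((n : ℂ) - 1) * (θ n - 1) + 1) * δ (n - 1) + 2 * (θ n - 1) * ω = 0) ∧
    (∀ n : ℕ, 1 ≤ n → (θ (n + 1) - 2) * θ n + 1 = 0) := by
  have hn0 : ∀ n : ℕ, 1 ≤ n → (n : ℂ) ≠ 0 := fun n hn => by
    exact_mod_cast (by omega : n ≠ 0)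
  have hn1 : ∀ n : ℕ, (n : ℂ) + 1 ≠ 0 := fun n => by exact_mod_cast (by omega : n + 1 ≠ 0)
  have hn2 : ∀ n : ℕ, (n : ℂ) + 2 ≠ 0 := fun n => by exact_mod_cast (by omega : n + 2 ≠ 0)
  have htβ : ∀ n, tβ n = δ n + β (n + 1) := fun n => by rw [hδ]; ring
  have ht : ∀ n : ℕ, 1 ≤ n → ((n : ℂ) + 1) * tγ n = (n : ℂ) * θ n * γ (n + 1) := by
    intro n hn
    have a := hn0 n hn
    have b := hγ n
    rw [hθ n hn]
    field_simp
  have ht' : ∀ n : ℕ, ((n : ℂ) + 2) * tγ (n + 1) = ((n : ℂ) + 1) * θ (n + 1) * γ (n + 2) := by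
    intro n
    have := ht (n + 1) (by omega)
    push_cast at this
    linear_combination this
  have hpred : ∀ n : ℕ, 1 ≤ n → tβ (n - 1) = δ (n - 1) + β n := by
    intro n hn
    have := htβ (n - 1)
    rwa [Nat.sub_add_cancel hn] at this
  have hB : ∀ n : ℕ, 1 ≤ n →
      β (n + 1) - β n = (n : ℂ) * δ (n - 1) - ((n : ℂ) + 2) * δ n - ω := by
    intro n hn
    have := h1 n hn
    rw [htβ n, hpred n hn] at this
    linear_combination this
  refine ⟨?_, hB, ?_, ?_, ?_, ?_⟩
  · rw [htβ 0] at h2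
    simp only [zero_add] at h2
    linear_combination h2
  · intro n hn
    have a := hn1 n
    have b := hn2 n
    have e := h3 n hn
    rw [htβ n] at e
    field_simp
    linear_combination ((n : ℂ) + 2) * e - ((n : ℂ) + 3) * ht' n + ((n : ℂ) + 2) * ht n hn
  · have e := ht' 0
    rw [htβ 0] at h4
    simp only [zero_add, Nat.cast_zero] at e h4
    linear_combination 2 * h4 - 3 * e
  · intro n hn
    have e := h5 n hn
    rw [ht n hn, htβ n, hpred n hn] at e
    have c : (n : ℂ) * γ (n + 1) ≠ 0 := mul_ne_zero (hn0 n hn) (hγ n)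
    apply mul_left_cancel₀ c
    linear_combination -e + (n : ℂ) * γ (n + 1) * (θ n - 1) * hB n hn
  · intro n hn
    have c : (n : ℂ) * γ (n + 1) * γ (n + 2) * ((n : ℂ) + 1) ≠ 0 :=
      mul_ne_zero (mul_ne_zero (mul_ne_zero (hn0 n hn) (hγ n)) (hγ (n + 1))) (hn1 n)
    apply mul_left_cancel₀ c
    linear_combination ((n : ℂ) + 1) * h6 n hn
      - (((n : ℂ) + 2) * tγ (n + 1) - 2 * ((n : ℂ) + 1) * γ (n + 2)) * ht n hn
      - (n : ℂ) * θ n * γ (n + 1) * ht' n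
end

section
/- Let {P_n}_{n≥0} be a monic PS and, for k ≥ 1, define the normalized D_ω-derivative sequences P^{[0]}_n := P_n and P^{[k]}_n := (n+1)^{-1} D_ω P^{[k−1]}_{n+1}. Suppose that for every k ≥ 0 the monic PS {P^{[k]}_n}_{n≥0} satisfies the three-term recurrence with coefficients (β^{[k]}_n), (γ^{[k]}_{n+1}), and that γ_{m} := γ^{[0]}_{m} ≠ 0 for all m ≥ 1. Define δ_n := β^{[1]}_n − β_{n+1} for n ≥ 0 and θ_n := (n+1)γ^{[1]}_n/(n γ_{n+1}) for n ≥ 1 (where β_n := β^{[0]}_n). Then for every k ≥ 1: β^{[k]}_n = β_{n+k} + k δ_{n+k−1} for all n ≥ 0, and γ^{[k]}_n = (n/(n+k))·γ_{n+k}·( k(θ_{n+k−1} − 1) + 1 ) for all n ≥ 1. -/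
open Polynomial

lemma Dw_add' (ω : ℂ) (f g : Polynomial ℂ) : Dw ω (f + g) = Dw ω f + Dw ω g := by
  simp only [Dw, add_comp]; ring

lemma Dw_sub' (ω : ℂ) (f g : Polynomial ℂ) : Dw ω (f - g) = Dw ω f - Dw ω g := by
  simp only [Dw, sub_comp]; ring

lemma Dw_C_mul' (ω a : ℂ) (f : Polynomial ℂ) : Dw ω (C a * f) = C a * Dw ω f := by
  simp only [Dw, mul_comp, C_comp]; ring

lemma Dw_one' (ω : ℂ) : Dw ω 1 = 0 := by
  simp [Dw]

lemma Dw_X_sub_mul' (ω : ℂ) (hω : ω ≠ 0) (b : ℂ) (f : Polynomial ℂ) :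
    Dw ω ((X - C b) * f) = (X + C ω - C b) * Dw ω f + f := by
  have h : (C ω⁻¹ * C ω : Polynomial ℂ) = 1 := by
    rw [← C_mul, inv_mul_cancel₀ hω, C_1]
  simp only [Dw, mul_comp, sub_comp, X_comp, C_comp]
  linear_combination f * h

/-- Two consecutive members of a monic PS are linearly independent. -/
lemma indep_two (R : ℕ → Polynomial ℂ) (hR : MonicPS R) (n : ℕ) (a b : ℂ)
    (h : C a * R (n + 1) + C b * R n = 0) : a = 0 ∧ b = 0 := by
  have c1 : (R (n + 1)).coeff (n + 1) = 1 := by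
    have := (hR (n + 1)).1.coeff_natDegree
    rwa [(hR (n + 1)).2] at this
  have c2 : (R n).coeff n = 1 := by
    have := (hR n).1.coeff_natDegree
    rwa [(hR n).2] at this
  have c3 : (R n).coeff (n + 1) = 0 :=
    coeff_eq_zero_of_natDegree_lt (by rw [(hR n).2]; omega)
  have ha : a = 0 := by
    have := congrArg (fun p => p.coeff (n + 1)) h
    simpa [c1, c3] using this
  refine ⟨ha, ?_⟩
  have := congrArg (fun p => p.coeff n) h
  simpa [c2, ha] using this

/-- The structure relation `P_{n+1} = Q_{n+1} + a_n Q_n + b_n Q_{n-1}`. -/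
lemma struct_rel (ω : ℂ) (hω : ω ≠ 0) (P Q : ℕ → Polynomial ℂ)
    (hD : ∀ n : ℕ, Dw ω (P (n + 1)) = C ((n : ℂ) + 1) * Q n)
    (β γ β' γ' : ℕ → ℂ) (hP : TTR P β γ) (hQ : TTR Q β' γ') :
    P 1 = Q 1 + C (β 1 - β' 0 - ω) ∧
    ∀ n : ℕ, P (n + 2) = Q (n + 2) + C (((n : ℂ) + 2) * (β (n + 2) - β' (n + 1) - ω)) * Q (n + 1)
      + C (((n : ℂ) + 1) * γ (n + 2) - ((n : ℂ) + 2) * γ' (n + 1)) * Q n := by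
  obtain ⟨p0, p1, p⟩ := hP
  obtain ⟨q0, q1, q⟩ := hQ
  constructor
  · have h := congrArg (Dw ω) (p 0)
    rw [Dw_sub', Dw_C_mul', Dw_X_sub_mul' ω hω, p0, Dw_one', hD 0, hD 1, q0] at h
    simp only [zero_add, Nat.cast_zero, Nat.cast_one, C_add, C_1, C_sub] at h ⊢
    linear_combination -h + q1
  · intro n
    have h := congrArg (Dw ω) (p (n + 1))
    have hd1 := hD (n + 1)
    have hd2 := hD (n + 2)
    rw [Dw_sub', Dw_C_mul', Dw_X_sub_mul' ω hω, hD n, hd1, hd2] at h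
    have hq := q n
    push_cast at h
    simp only [C_add, C_1, C_sub, C_mul, C_ofNat, add_assoc, Nat.reduceAdd] at h ⊢
    linear_combination -h + (C (n : ℂ) + 2) * hq

/-- Compatibility of two successive structure relations. -/
lemma compat (ω : ℂ) (P Q R : ℕ → Polynomial ℂ)
    (hR : MonicPS R) (p0 : Q 0 = 1) (r0 : R 0 = 1)
    (hD : ∀ n : ℕ, Dw ω (P (n + 1)) = C ((n : ℂ) + 1) * Q n)
    (hD' : ∀ n : ℕ, Dw ω (Q (n + 1)) = C ((n : ℂ) + 1) * R n)
    (a b a' b' : ℕ → ℂ) (c' : ℂ)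
    (hP : ∀ n : ℕ, P (n + 2) = Q (n + 2) + C (a n) * Q (n + 1) + C (b n) * Q n)
    (hQ1 : Q 1 = R 1 + C c')
    (hQ : ∀ n : ℕ, Q (n + 2) = R (n + 2) + C (a' n) * R (n + 1) + C (b' n) * R n) :
    2 * c' = a 0 ∧ ∀ n : ℕ, ((n : ℂ) + 3) * a' n = ((n : ℂ) + 2) * a (n + 1) ∧
      ((n : ℂ) + 3) * b' n = ((n : ℂ) + 1) * b (n + 1) := by
  constructor
  · have h := congrArg (Dw ω) (hP 0)
    have h1 := hD 1
    have h2 := hD' 0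
    have h3 := hD' 1
    simp only [zero_add, Nat.reduceAdd] at h h1 h2 h3
    rw [Dw_add', Dw_add', Dw_C_mul', Dw_C_mul', p0, Dw_one', h1, h2, h3, r0, hQ1] at h
    simp only [Nat.cast_zero, Nat.cast_one, C_add, C_1, zero_add] at h
    apply C_injective
    rw [C_mul, C_ofNat]
    linear_combination h
  · intro n
    have h := congrArg (Dw ω) (hP (n + 1))
    have h1 := hD (n + 2)
    have h2 := hD' (n + 1)
    have h3 := hD' (n + 2)
    rw [Dw_add', Dw_add', Dw_C_mul', Dw_C_mul', h1, h2, h3, hD' n] at h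
    have hq := hQ n
    push_cast at h
    have key := indep_two R hR n (((n : ℂ) + 3) * a' n - ((n : ℂ) + 2) * a (n + 1))
      (((n : ℂ) + 3) * b' n - ((n : ℂ) + 1) * b (n + 1)) (by
        simp only [C_add, C_1, C_sub, C_mul, C_ofNat, add_assoc, Nat.reduceAdd] at h ⊢
        linear_combination h - (C (n : ℂ) + 3) * hq)
    exact ⟨sub_eq_zero.mp key.1, sub_eq_zero.mp key.2⟩

theorem higher_order_derivative_recurrence_coefficients
    (ω : ℂ) (hω : ω ≠ 0) (Pk : ℕ → ℕ → Polynomial ℂ)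
    (hmonic : ∀ k, MonicPS (Pk k))
    (hrec : ∀ k n : ℕ, Pk (k + 1) n = ((n : ℂ) + 1)⁻¹ • Dw ω (Pk k (n + 1)))
    (βk γk : ℕ → ℕ → ℂ)
    (hTTR : ∀ k, TTR (Pk k) (βk k) (γk k))
    (hγ : ∀ m : ℕ, 1 ≤ m → γk 0 m ≠ 0)
    (δ θ : ℕ → ℂ)
    (hδ : ∀ n : ℕ, δ n = βk 1 n - βk 0 (n + 1))
    (hθ : ∀ n : ℕ, 1 ≤ n →
        θ n = ((n : ℂ) + 1) * γk 1 n / ((n : ℂ) * γk 0 (n + 1))) :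
    ∀ k : ℕ, 1 ≤ k →
      (∀ n : ℕ, βk k n = βk 0 (n + k) + (k : ℂ) * δ (n + k - 1)) ∧
      (∀ n : ℕ, 1 ≤ n →
        γk k n = ((n : ℂ) / ((n : ℂ) + (k : ℂ))) * γk 0 (n + k)
          * ((k : ℂ) * (θ (n + k - 1) - 1) + 1)) := by
  
  have hn1 : ∀ n : ℕ, (n : ℂ) + 1 ≠ 0 := fun n => Nat.cast_add_one_ne_zero n
  have hn2 : ∀ n : ℕ, (n : ℂ) + 2 ≠ 0 := fun n => by exact_mod_cast (by omega : n + 2 ≠ 0)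
  have hn3 : ∀ n : ℕ, (n : ℂ) + 3 ≠ 0 := fun n => by exact_mod_cast (by omega : n + 3 ≠ 0)
  have hD : ∀ k n : ℕ, Dw ω (Pk k (n + 1)) = C ((n : ℂ) + 1) * Pk (k + 1) n := by
    intro k n
    rw [hrec, smul_eq_C_mul, ← mul_assoc, ← C_mul, mul_inv_cancel₀ (hn1 n), C_1, one_mul]
  have hS := fun k => struct_rel ω hω (Pk k) (Pk (k + 1)) (hD k) _ _ _ _ (hTTR k) (hTTR (k + 1))
  have hC := fun k => compat ω (Pk k) (Pk (k + 1)) (Pk (k + 2)) (hmonic _) (hTTR _).1 (hTTR _).1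
    (hD k) (hD (k + 1)) _ _ _ _ _ (hS k).2 (hS (k + 1)).1 (hS (k + 1)).2
  have hE : ∀ k n : ℕ, βk (k + 2) n - βk (k + 1) (n + 1)
      = βk (k + 1) (n + 1) - βk k (n + 2) := by
    intro k n
    rcases n with _ | n
    · have h := (hC k).1
      simp only [Nat.cast_zero, zero_add] at h
      simp only [zero_add]
      linear_combination (-1 / 2 : ℂ) * h
    · have h := ((hC k).2 n).1
      push_cast at h
      apply mul_left_cancel₀ (mul_ne_zero (hn3 n) (hn2 n))
      simp only [add_assoc, Nat.reduceAdd] at h ⊢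
      linear_combination -h
  have hF : ∀ k n : ℕ, γk (k + 2) (n + 1) / ((n : ℂ) + 1) - γk (k + 1) (n + 2) / ((n : ℂ) + 2)
      = γk (k + 1) (n + 2) / ((n : ℂ) + 2) - γk k (n + 3) / ((n : ℂ) + 3) := by
    intro k n
    have h := ((hC k).2 n).2
    push_cast at h
    have := hn1 n
    have := hn2 n
    have := hn3 n
    field_simp
    simp only [add_assoc, Nat.reduceAdd] at h ⊢
    linear_combination -h
  have hE' : ∀ k n : ℕ, βk (k + 1) n - βk k (n + 1) = δ (n + k) := by
    intro k
    induction k with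
    | zero => intro n; rw [hδ]; rfl
    | succ k ih =>
      intro n
      rw [hE k n, ih (n + 1)]
      congr 1; omega
  have hF' : ∀ k n : ℕ, γk (k + 1) (n + 1) / ((n : ℂ) + 1) - γk k (n + 2) / ((n : ℂ) + 2)
      = γk 0 (n + k + 2) / ((n : ℂ) + k + 2) * (θ (n + k + 1) - 1) := by
    intro k
    induction k with
    | zero =>
      intro n
      rw [hθ _ (by omega)]
      have := hn1 n
      have := hn2 n
      have hg := hγ (n + 2) (by omega)
      simp only [add_zero, Nat.cast_zero, zero_add, add_assoc, Nat.reduceAdd] at *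
      push_cast
      have e : (n : ℂ) + 1 + 1 = n + 2 := by ring
      rw [e]
      field_simp
    | succ k ih =>
      intro n
      have h := hF k n
      have h2 := ih (n + 1)
      have e1 : n + 1 + k = n + (k + 1) := by omega
      have e2 : ((n : ℂ) + 1 + 2) = n + 3 := by ring
      have e3 : ((n : ℂ) + 1 + 1) = n + 2 := by ring
      have e4 : ((n : ℂ) + 1 + k) = n + (k + 1) := by ring
      push_cast at h2 ⊢
      rw [e1, e2, e3, e4] at h2
      rw [h, ← h2]
  have hβ : ∀ k n : ℕ, βk k n = βk 0 (n + k) + (k : ℂ) * δ (n + k - 1) := by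
    intro k
    induction k with
    | zero => intro n; simp
    | succ k ih =>
      intro n
      have h := hE' k n
      have h2 := ih (n + 1)
      have e1 : n + 1 + k = n + (k + 1) := by omega
      have e2 : n + (k + 1) - 1 = n + k := by omega
      rw [e1, e2] at h2
      rw [e2]
      push_cast
      linear_combination h + h2
  have hG : ∀ k n : ℕ, γk k (n + 1) / ((n : ℂ) + 1) = γk 0 (n + k + 1) / ((n : ℂ) + k + 1)
      * ((k : ℂ) * (θ (n + k) - 1) + 1) := by
    intro k
    induction k with
    | zero => intro n; simp
    | succ k ih =>
      intro n
      have h := hF' k n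
      have h2 := ih (n + 1)
      have e1 : n + 1 + k = n + k + 1 := by omega
      have e3 : ((n : ℂ) + 1 + 1) = n + 2 := by ring
      have e4 : ((n : ℂ) + 1 + k + 1) = n + k + 2 := by ring
      have e5 : ((n : ℂ) + (k + 1) + 1) = n + k + 2 := by ring
      push_cast at h2 ⊢
      rw [e1, e3, e4] at h2
      rw [e5, ← add_assoc n k 1]
      simp only [add_assoc, Nat.reduceAdd] at h h2 ⊢
      linear_combination h + h2
  intro k _
  refine ⟨hβ k, ?_⟩
  intro n hn
  obtain ⟨m, rfl⟩ : ∃ m, n = m + 1 := ⟨n - 1, by omega⟩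
  have h := hG k m
  rw [div_eq_iff (hn1 m)] at h
  have e1 : m + 1 + k = m + k + 1 := by omega
  have e2 : m + k + 1 - 1 = m + k := by omega
  have e3 : ((m : ℂ) + 1 + k) = m + k + 1 := by ring
  rw [e1, e2, h]
  push_cast
  rw [e3]
  ring
end
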